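/- Assume the set of resonances of the 1-D photonic crystal H_ε is nonempty. Then it is infinite, and there exists γ_0 > 0 such that every resonance k satisfies −γ_0 ≤ Im k < 0 (in particular, there are no real resonances). -/

import Mathlib

open Complex Real Filter Topology

noncomputable section

/-- The `j`-th layer of the 1-D photonic crystal: `(−∞, x₀)`, `(x_{j−1}, x_j)`, `(x_N, +∞)`. -/
def crysInterval (N : ℕ) (x : ℕ → ℝ) (j : ℕ) : Set ℝ :=
  if j = 0 then Set.Iio (x 0) else if j = N + 1 then Set.Ioi (x N) else Set.Ioo (x (j - 1)) (x j)

/-- `k ≠ 0` is a resonance of the 1-D photonic crystal `H_ε`: there exists a nontrivial `C¹`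
function `f`, twice differentiable on each layer where it satisfies `f'' = −k²ε_j f`, which
satisfies the outgoing radiation conditions on the two outer layers. -/
def IsResonance (N : ℕ) (x ε : ℕ → ℝ) (k : ℂ) : Prop :=
  k ≠ 0 ∧ ∃ f : ℝ → ℂ, f ≠ 0 ∧ ContDiff ℝ 1 f ∧
    (∀ j ≤ N + 1, ∀ t ∈ crysInterval N x j,
      DifferentiableAt ℝ (deriv f) t ∧
      deriv (deriv f) t = -(k ^ 2) * (ε j : ℂ) * f t) ∧
    (∀ t : ℝ, t ≤ x 0 →
      f t = f (x 0) * Complex.exp (-(Complex.I * k * (Real.sqrt (ε 0) : ℂ)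
        * ((t : ℂ) - (x 0 : ℂ))))) ∧
    (∀ t : ℝ, x N ≤ t →
      f t = f (x N) * Complex.exp (Complex.I * k * (Real.sqrt (ε (N + 1)) : ℂ)
        * ((t : ℂ) - (x N : ℂ))))

/-- Propagation of the Cauchy data `s = (f, f' / (i k))` through a homogeneous layer of refractive
index `n`, where `e` is the phase factor `exp (i k n ℓ)` of a layer of length `ℓ`. -/
def layerStep (n : ℝ) (e : ℂ) (s : ℂ × ℂ) : ℂ × ℂ :=
  (((s.2 + n * s.1) * e - (s.2 - n * s.1) * e⁻¹) / (2 * n),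
    ((s.2 + n * s.1) * e + (s.2 - n * s.1) * e⁻¹) / 2)

/-- The Cauchy data at the `j`-th interface of the solution which is outgoing on the left. -/
def crystalState (n : ℕ → ℝ) (e : ℕ → ℂ) : ℕ → ℂ × ℂ
  | 0 => (1, -n 0)
  | j + 1 => layerStep (n (j + 1)) (e j) (crystalState n e j)

section Algebra

variable {n : ℝ} {e : ℂ} {s : ℂ × ℂ}

theorem layerStep_add (hn : 0 < n) :
    (layerStep n e s).2 + n * (layerStep n e s).1 = (s.2 + n * s.1) * e := by
  have : (n : ℂ) ≠ 0 := by exact_mod_cast hn.ne'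
  simp only [layerStep]
  generalize e⁻¹ = w
  field_simp
  ring

theorem layerStep_sub (hn : 0 < n) :
    (layerStep n e s).2 - n * (layerStep n e s).1 = (s.2 - n * s.1) * e⁻¹ := by
  have : (n : ℂ) ≠ 0 := by exact_mod_cast hn.ne'
  simp only [layerStep]
  field_simp
  ring

theorem layerStep_one (hn : 0 < n) : layerStep n 1 s = s := by
  have : (n : ℂ) ≠ 0 := by exact_mod_cast hn.ne'
  ext1
  · simp only [layerStep]
    field_simp
    ring
  · simp only [layerStep]
    field_simp
    ring

theorem layerStep_smul (c : ℂ) : layerStep n e (c • s) = c • layerStep n e s := by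
  ext1
  · simp only [layerStep, Prod.smul_fst, Prod.smul_snd, smul_eq_mul]
    ring
  · simp only [layerStep, Prod.smul_fst, Prod.smul_snd, smul_eq_mul]
    ring

theorem flux_eq (p f : ℂ) :
    4 * n * (p * (starRingEnd ℂ) f).re = normSq (p + n * f) - normSq (p - n * f) := by
  simp [Complex.normSq_apply]
  ring

theorem flux_layerStep_le (hn : 0 < n) (he : e ≠ 0) (he1 : ‖e‖ ≤ 1) :
    ((layerStep n e s).2 * (starRingEnd ℂ) (layerStep n e s).1).re
      ≤ (s.2 * (starRingEnd ℂ) s.1).re := by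
  have h1 := flux_eq (n := n) (layerStep n e s).2 (layerStep n e s).1
  have h2 := flux_eq (n := n) s.2 s.1
  rw [layerStep_add hn, layerStep_sub hn, map_mul, map_mul, map_inv₀] at h1
  have h3 : normSq e ≤ 1 := by
    rw [Complex.normSq_eq_norm_sq]
    exact pow_le_one₀ (norm_nonneg _) he1
  have h4 : 1 ≤ (normSq e)⁻¹ := (one_le_inv₀ (Complex.normSq_pos.2 he)).2 h3
  have h5 := mul_le_mul_of_nonneg_left h3 (normSq_nonneg (s.2 + n * s.1))
  have h6 := mul_le_mul_of_nonneg_left h4 (normSq_nonneg (s.2 - n * s.1))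
  have h7 : 4 * n * ((layerStep n e s).2 * (starRingEnd ℂ) (layerStep n e s).1).re
      ≤ 4 * n * (s.2 * (starRingEnd ℂ) s.1).re := by linarith
  exact le_of_mul_le_mul_left h7 (by positivity)

end Algebra

/-- The flux of a left-outgoing solution stays negative through non-amplifying layers, so it
cannot be outgoing on the right. -/
theorem crystalState_not_outgoing {N : ℕ} {n : ℕ → ℝ} (hn : ∀ j ≤ N, 0 < n j) {e : ℕ → ℂ}
    (he : ∀ j, e j ≠ 0) (he1 : ∀ j < N, ‖e j‖ ≤ 1) {ν : ℝ} (hν : 0 < ν) :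
    (crystalState n e N).2 ≠ ν * (crystalState n e N).1 := by
  have key : ∀ j ≤ N, ((crystalState n e j).2 * (starRingEnd ℂ) (crystalState n e j).1).re
      ≤ -n 0 := by
    intro j
    induction j with
    | zero => simp [crystalState]
    | succ j ih =>
      intro hj
      exact (flux_layerStep_le (hn _ hj) (he j) (he1 j (by omega))).trans (ih (by omega))
  intro h
  have h1 := key N le_rfl
  rw [h, mul_assoc, Complex.mul_conj, ← Complex.ofReal_mul, Complex.ofReal_re] at h1
  have := hn 0 (by omega)
  have := mul_nonneg hν.le (normSq_nonneg (crystalState n e N).1)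
  linarith

section Amplifying

variable {κ : Type*} {l : Filter κ}

/-- A strongly amplifying layer makes the growing component dominate the decaying one. -/
theorem layerStep_dominated {n : ℝ} (hn : 0 < n) {e : κ → ℂ}
    (he : Tendsto (fun k => ‖e k‖) l atTop) {s : κ → ℂ × ℂ} {C : ℝ} (hC : 0 ≤ C)
    (hs : ∀ᶠ k in l, ‖(s k).2 - n * (s k).1‖ ≤ C * ‖(s k).2 + n * (s k).1‖ ∧
      (s k).2 + n * (s k).1 ≠ 0) {δ : ℝ} (hδ : 0 < δ) :
    ∀ᶠ k in l, ‖(layerStep n (e k) (s k)).2 - n * (layerStep n (e k) (s k)).1‖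
        ≤ δ * ‖(layerStep n (e k) (s k)).2 + n * (layerStep n (e k) (s k)).1‖ ∧
      (layerStep n (e k) (s k)).2 + n * (layerStep n (e k) (s k)).1 ≠ 0 := by
  filter_upwards [hs, he.eventually_ge_atTop 1, he.eventually_ge_atTop (C / δ)] with k h h1 h2
  rw [layerStep_add hn, layerStep_sub hn, norm_mul, norm_mul, norm_inv]
  have hpos : 0 < ‖e k‖ := by linarith
  refine ⟨?_, mul_ne_zero h.2 (norm_pos_iff.1 hpos)⟩
  rw [← div_eq_mul_inv, div_le_iff₀ hpos]
  rw [div_le_iff₀ hδ] at h2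
  have h3 : C ≤ δ * ‖e k‖ * ‖e k‖ := by nlinarith
  calc _ ≤ _ := h.1
    _ ≤ (δ * ‖e k‖ * ‖e k‖) * ‖(s k).2 + n * (s k).1‖ := by gcongr
    _ = _ := by ring

/-- Dominance of the growing component is preserved, up to a constant, by an interface. -/
theorem interface_dominated {n m : ℝ} (hn : 0 < n) (hm : 0 < m) {p f : ℂ}
    (h : ‖p - n * f‖ ≤ 1 / 2 * ‖p + n * f‖) (h0 : p + n * f ≠ 0) :
    ‖p - m * f‖ ≤ 3 * ‖p + m * f‖ ∧ p + m * f ≠ 0 := by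
  set α := p + n * f with hα
  set β := p - n * f with hβ
  have e1 : 2 * n * (p + m * f) = ((n + m : ℝ) : ℂ) * α + ((n - m : ℝ) : ℂ) * β := by
    rw [hα, hβ]; push_cast; ring
  have e2 : 2 * n * (p - m * f) = ((n - m : ℝ) : ℂ) * α + ((n + m : ℝ) : ℂ) * β := by
    rw [hα, hβ]; push_cast; ring
  have hαpos : 0 < ‖α‖ := norm_pos_iff.2 h0
  have hab : |n - m| ≤ n + m := abs_le.2 ⟨by linarith, by linarith⟩
  have n1 : (n + m) * ‖α‖ - (n + m) * ‖β‖ ≤ 2 * n * ‖p + m * f‖ := by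
    have : ‖(2 * n * (p + m * f) : ℂ)‖ = 2 * n * ‖p + m * f‖ := by
      simp [abs_of_pos hn]
    rw [← this, e1]
    have h2 := norm_sub_le (((n + m : ℝ) : ℂ) * α + ((n - m : ℝ) : ℂ) * β)
      (((n - m : ℝ) : ℂ) * β)
    rw [add_sub_cancel_right, norm_mul, norm_mul, Complex.norm_real, Complex.norm_real,
      Real.norm_eq_abs, Real.norm_eq_abs, abs_of_pos (by positivity : 0 < n + m)] at h2
    have := mul_le_mul_of_nonneg_right hab (norm_nonneg β)
    linarith
  have n2 : 2 * n * ‖p - m * f‖ ≤ (n + m) * ‖α‖ + (n + m) * ‖β‖ := by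
    have : ‖(2 * n * (p - m * f) : ℂ)‖ = 2 * n * ‖p - m * f‖ := by
      simp [abs_of_pos hn]
    rw [← this, e2]
    have h2 := norm_add_le (((n - m : ℝ) : ℂ) * α) (((n + m : ℝ) : ℂ) * β)
    rw [norm_mul, norm_mul, Complex.norm_real, Complex.norm_real,
      Real.norm_eq_abs, Real.norm_eq_abs, abs_of_pos (by positivity : 0 < n + m)] at h2
    have := mul_le_mul_of_nonneg_right hab (norm_nonneg α)
    linarith
  have n3 := mul_le_mul_of_nonneg_left h (by positivity : 0 ≤ n + m)
  have n4 : 0 < (n + m) * ‖α‖ := by positivity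
  constructor
  · have : 2 * n * ‖p - m * f‖ ≤ 2 * n * (3 * ‖p + m * f‖) := by linarith
    exact le_of_mul_le_mul_left this (by positivity)
  · intro h5
    rw [h5, norm_zero] at n1
    linarith

/-- Either the left-outgoing wave has met no index jump, or it is dominated by its growing
component as the amplification of every layer tends to infinity. -/
theorem crystalState_dichotomy {N : ℕ} {n : ℕ → ℝ} (hn : ∀ j ≤ N, 0 < n j) {e : κ → ℕ → ℂ}
    (he0 : ∀ k j, e k j ≠ 0) (he : ∀ j < N, Tendsto (fun k => ‖e k j‖) l atTop) :
    ∀ j ≤ N, (∀ k, (crystalState n (e k) j).2 = -n j * (crystalState n (e k) j).1 ∧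
        (crystalState n (e k) j).1 ≠ 0) ∨
      ∀ δ : ℝ, 0 < δ → ∀ᶠ k in l,
        ‖(crystalState n (e k) j).2 - n j * (crystalState n (e k) j).1‖
          ≤ δ * ‖(crystalState n (e k) j).2 + n j * (crystalState n (e k) j).1‖ ∧
        (crystalState n (e k) j).2 + n j * (crystalState n (e k) j).1 ≠ 0 := by
  intro j
  induction j with
  | zero => intro _; left; intro k; simp [crystalState]
  | succ j ih =>
    intro hj
    have hnj := hn j (by omega)
    have hnj1 := hn (j + 1) hj
    rcases ih (by omega) with h | h
    · by_cases hjump : n (j + 1) = n j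
      · left
        intro k
        obtain ⟨h1, h2⟩ := h k
        have hC : (n j : ℂ) ≠ 0 := by exact_mod_cast hnj.ne'
        have hstep : crystalState n (e k) (j + 1)
            = ((e k j)⁻¹ * (crystalState n (e k) j).1,
              -n j * ((e k j)⁻¹ * (crystalState n (e k) j).1)) := by
          rw [crystalState, hjump]
          ext1
          · simp only [layerStep, h1]
            field_simp
            ring
          · simp only [layerStep, h1]
            ring
        rw [hstep, hjump]
        exact ⟨rfl, mul_ne_zero (inv_ne_zero (he0 k j)) h2⟩
      · right
        intro δ hδ
        have hd : 0 < |n (j + 1) - n j| := abs_pos.2 (sub_ne_zero.2 hjump)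
        refine layerStep_dominated hnj1 (he j (by omega))
          (C := (n j + n (j + 1)) / |n (j + 1) - n j|) (by positivity) ?_ hδ
        refine Eventually.of_forall fun k => ?_
        obtain ⟨h1, h2⟩ := h k
        have e1 : (crystalState n (e k) j).2 - n (j + 1) * (crystalState n (e k) j).1
            = ((-(n j + n (j + 1)) : ℝ) : ℂ) * (crystalState n (e k) j).1 := by
          rw [h1]; push_cast; ring
        have e2 : (crystalState n (e k) j).2 + n (j + 1) * (crystalState n (e k) j).1
            = ((n (j + 1) - n j : ℝ) : ℂ) * (crystalState n (e k) j).1 := by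
          rw [h1]; push_cast; ring
        rw [e1, e2]
        constructor
        · rw [norm_mul, norm_mul, Complex.norm_real, Complex.norm_real, norm_neg,
            Real.norm_eq_abs, Real.norm_eq_abs, abs_of_pos (by positivity : 0 < n j + n (j + 1)),
            ← mul_assoc, div_mul_cancel₀ _ hd.ne']
        · exact mul_ne_zero (by exact_mod_cast sub_ne_zero.2 hjump) h2
    · right
      intro δ hδ
      refine layerStep_dominated hnj1 (he j (by omega)) (C := 3) (by norm_num) ?_ hδ
      filter_upwards [h (1 / 2) (by norm_num)] with k hk
      exact interface_dominated hnj hnj1 hk.1 hk.2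

/-- For strongly amplifying layers a left-outgoing solution is not outgoing on the right. -/
theorem crystalState_eventually_not_outgoing {N : ℕ} {n : ℕ → ℝ} (hn : ∀ j ≤ N, 0 < n j)
    {e : κ → ℕ → ℂ} (he0 : ∀ k j, e k j ≠ 0)
    (he : ∀ j < N, Tendsto (fun k => ‖e k j‖) l atTop) :
    ∀ j ≤ N, ∀ ν : ℝ, 0 < ν →
      ∀ᶠ k in l, (crystalState n (e k) j).2 ≠ ν * (crystalState n (e k) j).1 := by
  intro j
  induction j with
  | zero =>
    intro _ ν hν
    refine Eventually.of_forall fun k h => ?_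
    simp only [crystalState, mul_one] at h
    have h' : -n 0 = ν := by exact_mod_cast h
    have := hn 0 (by omega)
    linarith
  | succ j ih =>
    intro hj ν hν
    have hnj1 := hn (j + 1) hj
    by_cases hνn : ν = n (j + 1)
    · filter_upwards [ih (by omega) ν hν] with k hk h
      apply hk
      have h1 : (crystalState n (e k) (j + 1)).2
          - n (j + 1) * (crystalState n (e k) (j + 1)).1 = 0 := by rw [h, hνn, sub_self]
      rw [crystalState, layerStep_sub hnj1] at h1
      rw [hνn]
      exact sub_eq_zero.1 ((mul_eq_zero.1 h1).resolve_right (inv_ne_zero (he0 k j)))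
    · rcases crystalState_dichotomy hn he0 he (j + 1) hj with h | h
      · refine Eventually.of_forall fun k hk => ?_
        obtain ⟨h1, h2⟩ := h k
        rw [hk] at h1
        have h3 : (ν : ℂ) = -n (j + 1) := mul_right_cancel₀ h2 h1
        have h4 : ν = -n (j + 1) := by exact_mod_cast h3
        linarith
      · have hd : 0 < |ν - n (j + 1)| := abs_pos.2 (sub_ne_zero.2 hνn)
        filter_upwards [h (|ν - n (j + 1)| / (2 * (ν + n (j + 1)))) (by positivity)] with k hk hk'
        obtain ⟨h1, h2⟩ := hk
        rw [hk', ← sub_mul, ← add_mul, ← Complex.ofReal_sub, ← Complex.ofReal_add, norm_mul,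
          norm_mul, Complex.norm_real, Complex.norm_real, Real.norm_eq_abs, Real.norm_eq_abs,
          abs_of_pos (by positivity : 0 < ν + n (j + 1))] at h1
        rw [hk', ← add_mul] at h2
        have h3 : 0 < ‖(crystalState n (e k) (j + 1)).1‖ := norm_pos_iff.2 (right_ne_zero_of_mul h2)
        have h4 : |ν - n (j + 1)| / (2 * (ν + n (j + 1)))
            * ((ν + n (j + 1)) * ‖(crystalState n (e k) (j + 1)).1‖)
            = |ν - n (j + 1)| * ‖(crystalState n (e k) (j + 1)).1‖ / 2 := by
          field_simp
        rw [h4] at h1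
        have := mul_pos hd h3
        linarith

end Amplifying

/-- The Cauchy data at `t` of the solution with Cauchy data `s` at `a`, in a homogeneous medium of
refractive index `n`. -/
def layerSolution (n : ℝ) (k : ℂ) (a : ℝ) (s : ℂ × ℂ) (t : ℝ) : ℂ × ℂ :=
  layerStep n (Complex.exp (I * k * n * ((t : ℂ) - a))) s

section Layer

variable {n : ℝ} {k : ℂ} {a : ℝ} {s : ℂ × ℂ}

theorem hasDerivAt_exp_phase (c : ℂ) (a t : ℝ) :
    HasDerivAt (fun t : ℝ => Complex.exp (c * ((t : ℂ) - a)))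
      (Complex.exp (c * ((t : ℂ) - a)) * c) t := by
  have h1 : HasDerivAt (fun t : ℝ => (t : ℂ)) 1 t := Complex.ofRealCLM.hasDerivAt
  simpa using ((h1.sub_const (a : ℂ)).const_mul c).cexp

theorem exp_phase_inv (c u : ℂ) : (Complex.exp (c * u))⁻¹ = Complex.exp (-c * u) := by
  rw [← Complex.exp_neg, neg_mul]

theorem hasDerivAt_layerSolution_fst (hn : 0 < n) (t : ℝ) :
    HasDerivAt (fun t => (layerSolution n k a s t).1) (I * k * (layerSolution n k a s t).2) t := by
  have hC : (n : ℂ) ≠ 0 := by exact_mod_cast hn.ne'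
  simp only [layerSolution, layerStep, exp_phase_inv]
  refine HasDerivAt.congr_deriv ((((hasDerivAt_exp_phase (I * k * n) a t).const_mul (s.2 + n * s.1)).sub
    ((hasDerivAt_exp_phase (-(I * k * n)) a t).const_mul (s.2 - n * s.1))).div_const (2 * n : ℂ)) ?_
  field_simp
  ring

theorem hasDerivAt_layerSolution_snd (hn : 0 < n) (t : ℝ) :
    HasDerivAt (fun t => (layerSolution n k a s t).2)
      (I * k * n ^ 2 * (layerSolution n k a s t).1) t := by
  have hC : (n : ℂ) ≠ 0 := by exact_mod_cast hn.ne'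
  simp only [layerSolution, layerStep, exp_phase_inv]
  refine HasDerivAt.congr_deriv ((((hasDerivAt_exp_phase (I * k * n) a t).const_mul (s.2 + n * s.1)).add
    ((hasDerivAt_exp_phase (-(I * k * n)) a t).const_mul (s.2 - n * s.1))).div_const (2 : ℂ)) ?_
  field_simp
  ring

theorem layerSolution_self (hn : 0 < n) : layerSolution n k a s a = s := by
  simp [layerSolution, layerStep_one hn]

/-- A continuous function solving `u' = c u` in the interior of an interval is an exponential. -/
theorem eq_mul_exp_of_hasDerivAt {u : ℝ → ℂ} {c : ℂ} {a b : ℝ} (hu : Continuous u)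
    (hd : ∀ t ∈ Set.Ioo a b, HasDerivAt u (c * u t) t) {t : ℝ} (ht : t ∈ Set.Icc a b) :
    u t = u a * Complex.exp (c * ((t : ℂ) - a)) := by
  have hexp : Continuous fun t : ℝ => Complex.exp (-c * ((t : ℂ) - a)) := by fun_prop
  have h' : ∀ y ∈ Set.Icc a b, u y * Complex.exp (-c * ((y : ℂ) - a)) = u a := by
    intro y hy
    rcases hy.1.eq_or_lt with rfl | hay
    · simp
    have hder : ∀ z ∈ Set.Ioo a y,
        HasDerivAt (fun t => u t * Complex.exp (-c * ((t : ℂ) - a))) 0 z := by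
      intro z hz
      have := (hd z ⟨hz.1, hz.2.trans_le hy.2⟩).mul (hasDerivAt_exp_phase (-c) a z)
      exact this.congr_deriv (by ring)
    obtain ⟨m, hm⟩ : (Set.Ioo a y).Nonempty := Set.nonempty_Ioo.2 hay
    have hconst : Set.EqOn (fun t => u t * Complex.exp (-c * ((t : ℂ) - a)))
        (fun _ => u m * Complex.exp (-c * ((m : ℂ) - a))) (closure (Set.Ioo a y)) := by
      refine Set.EqOn.closure (fun z hz => ?_) (hu.mul hexp) continuous_const
      have := Convex.norm_image_sub_le_of_norm_hasDerivWithin_le (𝕜 := ℝ) (C := 0)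
        (fun z hz => (hder z hz).hasDerivWithinAt) (by simp) (convex_Ioo a y) hm hz
      rwa [zero_mul, norm_le_zero_iff, sub_eq_zero] at this
    rw [closure_Ioo hay.ne] at hconst
    simpa using (hconst (Set.right_mem_Icc.2 hay.le)).trans
      (hconst (Set.left_mem_Icc.2 hay.le)).symm
  rw [← h' t ht, mul_assoc, ← Complex.exp_add]
  simp

/-- In a homogeneous layer the Cauchy data of a solution of `f'' = -k² n² f` are those of the
explicit solution. -/
theorem cauchyData_eq_layerSolution (hn : 0 < n) (hk : k ≠ 0) {f : ℝ → ℂ} (hf : ContDiff ℝ 1 f)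
    {b : ℝ} (hode : ∀ t ∈ Set.Ioo a b, DifferentiableAt ℝ (deriv f) t ∧
      deriv (deriv f) t = -(k ^ 2) * (n : ℂ) ^ 2 * f t) {t : ℝ} (ht : t ∈ Set.Icc a b) :
    (f t, deriv f t / (I * k)) = layerSolution n k a (f a, deriv f a / (I * k)) t := by
  have hC : (n : ℂ) ≠ 0 := by exact_mod_cast hn.ne'
  have hdf : Differentiable ℝ f := hf.differentiable one_ne_zero
  have hcf : Continuous f := hf.continuous
  have hcd : Continuous (deriv f) := hf.continuous_deriv le_rfl
  have hd1 : ∀ t ∈ Set.Ioo a b, HasDerivAt (fun t => deriv f t / (I * k) + n * f t)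
      (I * k * n * (deriv f t / (I * k) + n * f t)) t := by
    intro t ht
    obtain ⟨h1, h2⟩ := hode t ht
    have := (h1.hasDerivAt.div_const (I * k)).add ((hdf t).hasDerivAt.const_mul (n : ℂ))
    refine this.congr_deriv ?_
    rw [h2]
    field_simp
    linear_combination -(k * n * f t) * I_sq
  have hd2 : ∀ t ∈ Set.Ioo a b, HasDerivAt (fun t => deriv f t / (I * k) - n * f t)
      (-(I * k * n) * (deriv f t / (I * k) - n * f t)) t := by
    intro t ht
    obtain ⟨h1, h2⟩ := hode t ht
    have := (h1.hasDerivAt.div_const (I * k)).sub ((hdf t).hasDerivAt.const_mul (n : ℂ))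
    refine this.congr_deriv ?_
    rw [h2]
    field_simp
    linear_combination -(k * n * f t) * I_sq
  have e1 := eq_mul_exp_of_hasDerivAt (by fun_prop) hd1 ht
  have e2 := eq_mul_exp_of_hasDerivAt (by fun_prop) hd2 ht
  simp only [layerSolution, layerStep, exp_phase_inv]
  rw [← e1, ← e2]
  ext1
  · field_simp
    ring
  · simp only
    ring

end Layer

section Glue

/-- Two differentiable functions whose values and derivatives agree at `c` glue to a
differentiable function. -/
theorem hasDerivAt_ite_le {u v u' v' : ℝ → ℂ} {c : ℝ} (hu : ∀ t, HasDerivAt u (u' t) t)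
    (hv : ∀ t, HasDerivAt v (v' t) t) (h : u c = v c) (h' : u' c = v' c) (t : ℝ) :
    HasDerivAt (fun t => if t ≤ c then u t else v t) (if t ≤ c then u' t else v' t) t := by
  rcases lt_trichotomy t c with htc | rfl | htc
  · rw [if_pos htc.le]
    refine (hu t).congr_of_eventuallyEq ?_
    filter_upwards [Iio_mem_nhds htc] with z hz
    rw [if_pos (le_of_lt hz)]
  · rw [if_pos le_rfl]
    have h1 : HasDerivWithinAt (fun z => if z ≤ t then u z else v z) (u' t) (Set.Iic t) t :=
      (hu t).hasDerivWithinAt.congr (fun z hz => if_pos hz) (if_pos le_rfl)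
    have h2 : HasDerivWithinAt (fun z => if z ≤ t then u z else v z) (u' t) (Set.Ici t) t := by
      rw [h']
      refine (hv t).hasDerivWithinAt.congr (fun z hz => ?_) (by rw [if_pos le_rfl, h])
      rcases (Set.mem_Ici.1 hz).eq_or_lt with rfl | hlt
      · rw [if_pos le_rfl, h]
      · rw [if_neg (not_le.2 hlt)]
    have := h1.union h2
    rwa [Set.Iic_union_Ici, hasDerivWithinAt_univ] at this
  · rw [if_neg (not_le.2 htc)]
    refine (hv t).congr_of_eventuallyEq ?_
    filter_upwards [Ioi_mem_nhds htc] with z hz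
    rw [if_neg (not_le.2 hz)]

end Glue

/-- The phase factors of the inner layers. -/
def crystalPhase (n x : ℕ → ℝ) (k : ℂ) (j : ℕ) : ℂ :=
  Complex.exp (I * k * n (j + 1) * ((x (j + 1) : ℂ) - x j))

/-- The left-outgoing solution in the `j`-th layer, extended to the whole line. For `j = 0` the
truncated index `j - 1` refers to the interface `x 0` as well. -/
def crystalLayer (n x : ℕ → ℝ) (k : ℂ) (j : ℕ) : ℝ → ℂ × ℂ :=
  layerSolution (n j) k (x (j - 1)) (crystalState n (crystalPhase n x k) (j - 1))

/-- The left-outgoing solution for the crystal consisting of the layers `0, …, j`, the last one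
being unbounded. -/
def crystalSolution (n x : ℕ → ℝ) (k : ℂ) : ℕ → ℝ → ℂ × ℂ
  | 0 => crystalLayer n x k 0
  | j + 1 => fun t => if t ≤ x j then crystalSolution n x k j t else crystalLayer n x k (j + 1) t

section Crystal

variable {N : ℕ} {n x : ℕ → ℝ} {k : ℂ}

theorem crystalSolution_succ (j : ℕ) (t : ℝ) : crystalSolution n x k (j + 1) t
    = if t ≤ x j then crystalSolution n x k j t else crystalLayer n x k (j + 1) t := rfl

theorem crystalSolution_interface (hn : ∀ j ≤ N + 1, 0 < n j) (hx : ∀ j < N, x j < x (j + 1)) :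
    ∀ j ≤ N, crystalSolution n x k j (x j) = crystalState n (crystalPhase n x k) j := by
  intro j hj
  cases j with
  | zero => exact layerSolution_self (hn 0 (by omega))
  | succ j =>
    rw [crystalSolution_succ, if_neg (not_le.2 (hx j (by omega)))]
    rfl

theorem hasDerivAt_crystalSolution (hn : ∀ j ≤ N + 1, 0 < n j) (hx : ∀ j < N, x j < x (j + 1)) :
    ∀ j ≤ N + 1, (∀ t, HasDerivAt (fun t => (crystalSolution n x k j t).1)
        (I * k * (crystalSolution n x k j t).2) t) ∧
      Continuous fun t => (crystalSolution n x k j t).2 := by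
  intro j
  induction j with
  | zero =>
    intro hj
    refine ⟨fun t => hasDerivAt_layerSolution_fst (hn 0 hj) t, ?_⟩
    exact continuous_iff_continuousAt.2
      fun t => (hasDerivAt_layerSolution_snd (hn 0 hj) t).continuousAt
  | succ j ih =>
    intro hj
    obtain ⟨ih1, ih2⟩ := ih (by omega)
    have hval : crystalSolution n x k j (x j) = crystalLayer n x k (j + 1) (x j) := by
      rw [crystalSolution_interface hn hx j (by omega)]
      exact (layerSolution_self (hn (j + 1) hj)).symm
    have hcont : Continuous fun t => (crystalLayer n x k (j + 1) t).2 :=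
      continuous_iff_continuousAt.2
        fun t => (hasDerivAt_layerSolution_snd (hn (j + 1) hj) t).continuousAt
    simp only [crystalSolution_succ, apply_ite Prod.fst, apply_ite Prod.snd]
    constructor
    · intro t
      have := hasDerivAt_ite_le (c := x j) ih1
        (fun t => hasDerivAt_layerSolution_fst (k := k) (a := x j)
          (s := crystalState n (crystalPhase n x k) j) (hn (j + 1) hj) t)
        (congrArg Prod.fst hval) (by rw [hval]; rfl) t
      rw [mul_ite]
      exact this
    · exact Continuous.if_le ih2 hcont continuous_id continuous_const
        (fun t ht => by rw [show t = x j from ht, hval])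

theorem interface_mono (hx : ∀ j < N, x j < x (j + 1)) {i j : ℕ} (hij : i ≤ j) (hj : j ≤ N) :
    x i ≤ x j := by
  induction j, hij using Nat.le_induction with
  | base => exact le_rfl
  | succ j hij ih => exact (ih (by omega)).trans (hx j (by omega)).le

theorem crystalSolution_eq_layer (hx : ∀ j < N, x j < x (j + 1)) :
    ∀ j ≤ N + 1, ∀ i ≤ j, ∀ t, (i ≠ 0 → x (i - 1) < t) → (i < j → t ≤ x i) →
      crystalSolution n x k j t = crystalLayer n x k i t := by
  intro j
  induction j with
  | zero =>
    intro _ i hi t _ _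
    obtain rfl : i = 0 := by omega
    rfl
  | succ j ih =>
    intro hj i hi t h1 h2
    rw [crystalSolution_succ]
    rcases hi.eq_or_lt with rfl | hlt
    · rw [if_neg (not_le.2 (by simpa using h1))]
    · have ht := h2 hlt
      rw [if_pos (ht.trans (interface_mono hx (by omega) (by omega)))]
      exact ih (by omega) i (by omega) t h1 (fun _ => ht)

theorem mem_crysInterval {j : ℕ} {t : ℝ} (ht : t ∈ crysInterval N x j) :
    (j ≠ 0 → x (j - 1) < t) ∧ (j < N + 1 → t < x j) := by
  unfold crysInterval at ht
  split_ifs at ht with h1 h2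
  · subst h1; exact ⟨by simp, fun _ => ht⟩
  · subst h2; exact ⟨fun _ => ht, by simp⟩
  · exact ⟨fun _ => ht.1, fun _ => ht.2⟩

theorem isOpen_crysInterval (j : ℕ) : IsOpen (crysInterval N x j) := by
  unfold crysInterval
  split_ifs
  · exact isOpen_Iio
  · exact isOpen_Ioi
  · exact isOpen_Ioo

end Crystal

section Resonance

variable {N : ℕ} {x ε : ℕ → ℝ} {k : ℂ}

theorem isResonance_of_outgoing (hx : ∀ j < N, x j < x (j + 1)) (hε : ∀ j ≤ N + 1, 0 < ε j)
    (hk : k ≠ 0)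
    (h : (crystalState (fun j => √(ε j)) (crystalPhase (fun j => √(ε j)) x k) N).2
      = (√(ε (N + 1)) : ℝ) *
        (crystalState (fun j => √(ε j)) (crystalPhase (fun j => √(ε j)) x k) N).1) :
    IsResonance N x ε k := by
  set n : ℕ → ℝ := fun j => √(ε j) with hndef
  have hn : ∀ j ≤ N + 1, 0 < n j := fun j hj => Real.sqrt_pos.2 (hε j hj)
  obtain ⟨hd, hc⟩ := hasDerivAt_crystalSolution (k := k) hn hx (N + 1) le_rfl
  have hderiv : deriv (fun t => (crystalSolution n x k (N + 1) t).1)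
      = fun t => I * k * (crystalSolution n x k (N + 1) t).2 := funext fun t => (hd t).deriv
  have hleft : ∀ t ≤ x 0, (crystalSolution n x k (N + 1) t).1
      = Complex.exp (-(I * k * n 0 * ((t : ℂ) - x 0))) := by
    intro t ht
    rw [crystalSolution_eq_layer hx (N + 1) le_rfl 0 (by omega) t (by simp) (fun _ => ht)]
    have h0 : (n 0 : ℂ) ≠ 0 := by exact_mod_cast (hn 0 (by omega)).ne'
    simp only [crystalLayer, layerSolution, layerStep, Nat.zero_sub, crystalState, exp_phase_inv]
    field_simp
    ring_nf
  have hright : ∀ t, x N ≤ t → (crystalSolution n x k (N + 1) t).1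
      = (crystalState n (crystalPhase n x k) N).1
        * Complex.exp (I * k * n (N + 1) * ((t : ℂ) - x N)) := by
    intro t ht
    have h0 : (n (N + 1) : ℂ) ≠ 0 := by exact_mod_cast (hn (N + 1) le_rfl).ne'
    have hlayer : (crystalLayer n x k (N + 1) t).1 = (crystalState n (crystalPhase n x k) N).1
        * Complex.exp (I * k * n (N + 1) * ((t : ℂ) - x N)) := by
      simp only [crystalLayer, layerSolution, layerStep, Nat.add_sub_cancel]
      rw [h]
      field_simp
      ring
    rcases ht.eq_or_lt with rfl | hlt
    · rw [crystalSolution_succ, if_pos le_rfl, crystalSolution_interface hn hx N le_rfl]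
      simp
    · rw [crystalSolution_succ, if_neg (not_le.2 hlt), hlayer]
  refine ⟨hk, fun t => (crystalSolution n x k (N + 1) t).1, ?_, ?_, ?_, ?_, ?_⟩
  · intro h0
    have := congrFun h0 (x 0)
    simp only [hleft (x 0) le_rfl, Pi.zero_apply] at this
    exact Complex.exp_ne_zero _ this
  · rw [contDiff_one_iff_deriv, hderiv]
    exact ⟨fun t => (hd t).differentiableAt, by fun_prop⟩
  · intro j hj t ht
    rw [hderiv]
    have heq : ∀ z ∈ crysInterval N x j,
        crystalSolution n x k (N + 1) z = crystalLayer n x k j z := fun z hz =>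
      crystalSolution_eq_layer hx (N + 1) le_rfl j hj z (mem_crysInterval hz).1
        fun hj => ((mem_crysInterval hz).2 hj).le
    have h1 : HasDerivAt (fun t => I * k * (crystalSolution n x k (N + 1) t).2)
        (I * k * (I * k * n j ^ 2 * (crystalLayer n x k j t).1)) t := by
      refine ((hasDerivAt_layerSolution_snd (hn j hj) t).const_mul (I * k)).congr_of_eventuallyEq ?_
      filter_upwards [(isOpen_crysInterval j).mem_nhds ht] with z hz
      rw [heq z hz]
      rfl
    refine ⟨h1.differentiableAt, ?_⟩
    have hsq : (n j : ℂ) ^ 2 = ε j := by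
      exact_mod_cast Real.sq_sqrt (hε j hj).le
    simp only [h1.deriv, heq t ht, hsq]
    linear_combination (k ^ 2 * (ε j : ℂ) * (crystalLayer n x k j t).1) * I_sq
  · intro t ht
    simp only [hleft t ht, hleft (x 0) le_rfl]
    simp [hndef]
  · intro t ht
    simp only [hright t ht, hright (x N) le_rfl]
    simp [hndef]

theorem IsResonance.outgoing (hx : ∀ j < N, x j < x (j + 1))
    (hε : ∀ j ≤ N + 1, 0 < ε j) (h : IsResonance N x ε k) :
    (crystalState (fun j => √(ε j)) (crystalPhase (fun j => √(ε j)) x k) N).2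
      = (√(ε (N + 1)) : ℝ) *
        (crystalState (fun j => √(ε j)) (crystalPhase (fun j => √(ε j)) x k) N).1 := by
  obtain ⟨hk, f, hf0, hf, hode, hleft, hright⟩ := h
  set n : ℕ → ℝ := fun j => √(ε j) with hndef
  have hn : ∀ j ≤ N + 1, 0 < n j := fun j hj => Real.sqrt_pos.2 (hε j hj)
  have hIk : I * k ≠ 0 := mul_ne_zero I_ne_zero hk
  have hdf : Differentiable ℝ f := hf.differentiable one_ne_zero
  have hd0 : deriv f (x 0) / (I * k) = -n 0 * f (x 0) := by
    have h1 : HasDerivWithinAt f (f (x 0) * (Complex.exp (-(I * k * n 0) * ((x 0 : ℂ) - x 0))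
        * -(I * k * n 0))) (Set.Iic (x 0)) (x 0) := by
      refine ((hasDerivAt_exp_phase (-(I * k * n 0)) (x 0) (x 0)).const_mul
        (f (x 0))).hasDerivWithinAt.congr (fun t ht => ?_) (by simp)
      rw [hleft t ht, neg_mul]
    have h2 := (uniqueDiffWithinAt_Iic (x 0)).eq_deriv _ (hdf (x 0)).hasDerivAt.hasDerivWithinAt h1
    rw [h2, div_eq_iff hIk]
    simp
    ring
  have hdN : deriv f (x N) / (I * k) = n (N + 1) * f (x N) := by
    have h1 : HasDerivWithinAt f (f (x N) * (Complex.exp (I * k * n (N + 1) * ((x N : ℂ) - x N))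
        * (I * k * n (N + 1)))) (Set.Ici (x N)) (x N) := by
      refine ((hasDerivAt_exp_phase (I * k * n (N + 1)) (x N) (x N)).const_mul
        (f (x N))).hasDerivWithinAt.congr (fun t ht => ?_) (by simp)
      rw [hright t ht]
    have h2 := (uniqueDiffWithinAt_Ici (x N)).eq_deriv _ (hdf (x N)).hasDerivAt.hasDerivWithinAt h1
    rw [h2, div_eq_iff hIk]
    simp
    ring
  have hlayer : ∀ j < N, ∀ t ∈ Set.Icc (x j) (x (j + 1)), (f t, deriv f t / (I * k))
      = layerSolution (n (j + 1)) k (x j) (f (x j), deriv f (x j) / (I * k)) t := by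
    intro j hj t ht
    refine cauchyData_eq_layerSolution (hn (j + 1) (by omega)) hk hf (fun z hz => ?_) ht
    have hsq : (n (j + 1) : ℂ) ^ 2 = ε (j + 1) := by
      exact_mod_cast Real.sq_sqrt (hε (j + 1) (by omega)).le
    rw [hsq]
    apply hode (j + 1) (by omega) z
    rw [crysInterval, if_neg (by omega), if_neg (by omega)]
    exact hz
  have hstate : ∀ j ≤ N, (f (x j), deriv f (x j) / (I * k))
      = f (x 0) • crystalState n (crystalPhase n x k) j := by
    intro j
    induction j with
    | zero =>
      intro _
      rw [hd0]
      simp [crystalState, mul_comm]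
    | succ j ih =>
      intro hj
      rw [hlayer j (by omega) _ (Set.right_mem_Icc.2 (hx j (by omega)).le), ih (by omega),
        layerSolution, layerStep_smul]
      rfl
  have hf00 : f (x 0) ≠ 0 := by
    intro h0
    apply hf0
    have hfj : ∀ j ≤ N, f (x j) = 0 := by
      intro j hj
      have := congrArg Prod.fst (hstate j hj)
      simpa [h0] using this
    have hin : ∀ j ≤ N, ∀ t, x 0 ≤ t → t ≤ x j → f t = 0 := by
      intro j
      induction j with
      | zero => intro _ t h1 h2; rw [le_antisymm h2 h1, h0]
      | succ j ih =>
        intro hj t h1 h2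
        rcases le_total t (x j) with h3 | h3
        · exact ih (by omega) t h1 h3
        · have := congrArg Prod.fst (hlayer j (by omega) t ⟨h3, h2⟩)
          rw [hstate j (by omega), h0, layerSolution, layerStep_smul] at this
          simpa using this
    funext t
    rcases le_total t (x 0) with h1 | h1
    · rw [hleft t h1, h0, zero_mul]; rfl
    rcases le_total t (x N) with h2 | h2
    · exact hin N le_rfl t h1 h2
    · rw [hright t h2, hfj N le_rfl, zero_mul]; rfl
  have hfin := hstate N le_rfl
  rw [hdN] at hfin
  have h1 := congrArg Prod.fst hfin
  have h2 := congrArg Prod.snd hfin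
  simp only [Prod.smul_fst, Prod.smul_snd, smul_eq_mul] at h1 h2
  rw [h1] at h2
  apply mul_left_cancel₀ hf00
  rw [← h2]
  ring

end Resonance

/-- Simultaneous recurrence of the phases `exp (i τ c_j)` along an unbounded sequence of `τ`. -/
theorem exists_recurrence (c : ℕ → ℝ) : ∃ τ : ℕ → ℝ, (∀ m : ℕ, (m : ℝ) ≤ τ m) ∧
    Tendsto (fun m j => Circle.exp (τ m * c j)) atTop (𝓝 (1 : ℕ → Circle)) := by
  obtain ⟨a, φ, hφ, ha⟩ := CompactSpace.tendsto_subseq fun (m : ℕ) (j : ℕ) =>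
    Circle.exp (m * c j)
  refine ⟨fun m => (φ (2 * m) : ℝ) - φ m, fun m => ?_, ?_⟩
  · have h := hφ.add_le_nat m m
    rw [le_sub_iff_add_le, two_mul]
    exact_mod_cast h
  · have h2 : Tendsto (fun m : ℕ => 2 * m) atTop atTop :=
      tendsto_atTop_mono (fun m => by simp only [id]; omega) tendsto_id
    have := (ha.comp h2).div' ha
    rw [div_self'] at this
    refine this.congr fun m => ?_
    funext j
    simp [sub_mul, Circle.exp_sub]

section Determinant

variable {N : ℕ} {n : ℕ → ℝ}

theorem continuous_crystalState {Y : Type*} [TopologicalSpace Y] {e : Y → ℕ → ℂ}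
    (he : ∀ j, Continuous fun y => e y j) (he0 : ∀ y j, e y j ≠ 0) (j : ℕ) :
    Continuous fun y => crystalState n (e y) j := by
  induction j with
  | zero => exact continuous_const
  | succ j ih =>
    have h1 := he j
    have h2 : Continuous fun y => (e y j)⁻¹ := h1.inv₀ fun y => he0 y j
    simp only [crystalState, layerStep]
    fun_prop

theorem differentiable_crystalState {e : ℂ → ℕ → ℂ} (he : ∀ j, Differentiable ℂ fun z => e z j)
    (he0 : ∀ z j, e z j ≠ 0) (j : ℕ) : Differentiable ℂ fun z => crystalState n (e z) j := by
  induction j with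
  | zero => exact differentiable_const _
  | succ j ih =>
    have h1 := he j
    have h2 : Differentiable ℂ fun z => (e z j)⁻¹ := h1.inv fun z => he0 z j
    have h3 : Differentiable ℂ fun z => (crystalState n (e z) j).1 := ih.fst
    have h4 : Differentiable ℂ fun z => (crystalState n (e z) j).2 := ih.snd
    simp only [crystalState, layerStep]
    fun_prop

end Determinant

/-- An entire function which recurs under arbitrarily large real translations, locally uniformly,
has infinitely many zeros as soon as it has one and is not identically zero. -/
theorem infinite_zeros_of_recurrent {D : ℂ → ℂ} (hD : Differentiable ℂ D) {τ : ℕ → ℝ}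
    (hτ : ∀ m : ℕ, (m : ℝ) ≤ τ m)
    (hrec : ∀ K : Set ℂ, IsCompact K → TendstoUniformlyOn (fun m z => D (z + τ m)) D atTop K)
    {z₀ z₁ : ℂ} (h₀ : D z₀ = 0) (h₁ : D z₁ ≠ 0) : {z | D z = 0}.Infinite := by
  have hiso : ∀ᶠ z in 𝓝[≠] z₀, D z ≠ 0 := by
    refine ((hD.analyticAt z₀).eventually_eq_zero_or_eventually_ne_zero).resolve_left fun h => ?_
    have hall : AnalyticOnNhd ℂ D Set.univ := fun z _ => hD.analyticAt z
    exact h₁ (hall.eqOn_zero_of_preconnected_of_eventuallyEq_zero isPreconnected_univ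
      (Set.mem_univ z₀) h (Set.mem_univ z₁))
  obtain ⟨R, hR, hball⟩ := Metric.eventually_nhds_iff_ball.1 (eventually_nhdsWithin_iff.1 hiso)
  set r := R / 2
  have hr : 0 < r := half_pos hR
  have hsphere : ∀ z ∈ Metric.sphere z₀ r, D z ≠ 0 := fun z hz =>
    hball z (Metric.sphere_subset_closedBall.trans
      (Metric.closedBall_subset_ball (half_lt_self hR)) hz) (Metric.ne_of_mem_sphere hz hr.ne')
  obtain ⟨w, hw, hmin⟩ := (isCompact_sphere z₀ r).exists_isMinOn
    (NormedSpace.sphere_nonempty.2 hr.le) hD.continuous.norm.continuousOn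
  set δ := ‖D w‖
  have hδ : 0 < δ := norm_pos_iff.2 (hsphere w hw)
  have hzero : ∀ᶠ m in atTop, ∃ z ∈ Metric.closedBall z₀ r, D (z + τ m) = 0 := by
    filter_upwards [Metric.tendstoUniformlyOn_iff.1 (hrec _ (isCompact_closedBall z₀ r)) (δ / 8)
      (by positivity)] with m hm
    have hg : Differentiable ℂ fun z => D (z + τ m) := hD.comp (differentiable_id.add_const _)
    have hc := hm z₀ (Metric.mem_closedBall_self hr.le)
    rw [h₀, dist_zero_left] at hc
    have hs : ∀ z ∈ Metric.sphere z₀ r, δ / 2 ≤ ‖D (z + τ m) - D (z₀ + τ m)‖ := by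
      intro z hz
      have h1 := hm z (Metric.sphere_subset_closedBall hz)
      rw [dist_eq_norm] at h1
      have h2 : δ ≤ ‖D z‖ := hmin hz
      have h3 : ‖D z‖ ≤ ‖D z - D (z + τ m)‖ + ‖D (z + τ m) - D (z₀ + τ m)‖ + ‖D (z₀ + τ m)‖ := by
        calc ‖D z‖ = ‖(D z - D (z + τ m)) + (D (z + τ m) - D (z₀ + τ m)) + D (z₀ + τ m)‖ := by
              congr 1; ring
          _ ≤ _ := norm_add₃_le
      linarith
    have hne : ∃ᶠ z in 𝓝 z₀, D (z + τ m) ≠ D (z₀ + τ m) := by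
      intro hcon
      have hcon' : ∀ᶠ z in 𝓝 z₀, D (z + τ m) = D (z₀ + τ m) := by simpa using hcon
      have hall : AnalyticOnNhd ℂ (fun z => D (z + τ m)) Set.univ := fun z _ => hg.analyticAt z
      have := hall.eqOn_of_preconnected_of_eventuallyEq (fun z _ => analyticAt_const)
        isPreconnected_univ (Set.mem_univ z₀) hcon' (Set.mem_univ w)
      have h4 := hs w hw
      simp only at this
      rw [this, sub_self, norm_zero] at h4
      linarith
    have := hg.diffContOnCl.ball_subset_image_closedBall hr hs hne
    obtain ⟨z, hz, hz0⟩ := this (show (0 : ℂ) ∈ _ by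
      rw [Metric.mem_ball, dist_zero_left]; linarith)
    exact ⟨z, hz, hz0⟩
  intro hfin
  obtain ⟨B, hB⟩ := hfin.isBounded.exists_norm_le
  obtain ⟨m, ⟨z, hz, hz0⟩, hmB⟩ :=
    (hzero.and (eventually_gt_atTop ⌈B + ‖z₀‖ + r⌉₊)).exists
  have h1 := hB _ hz0
  have h2 : (⌈B + ‖z₀‖ + r⌉₊ : ℝ) < m := by exact_mod_cast hmB
  have h3 := Nat.le_ceil (B + ‖z₀‖ + r)
  have h4 := hτ m
  have h5 : ‖(τ m : ℂ)‖ ≤ ‖z + τ m‖ + ‖z₀‖ + ‖z - z₀‖ := by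
    calc ‖(τ m : ℂ)‖ = ‖(z + τ m) - z₀ - (z - z₀)‖ := by congr 1; ring
      _ ≤ ‖(z + τ m) - z₀‖ + ‖z - z₀‖ := norm_sub_le _ _
      _ ≤ _ := by gcongr; exact norm_sub_le _ _
  rw [Complex.norm_real, Real.norm_eq_abs] at h5
  have h6 := le_abs_self (τ m)
  rw [Metric.mem_closedBall, dist_eq_norm] at hz
  linarith

section Phase

variable {n x : ℕ → ℝ}

theorem crystalPhase_ne_zero (k : ℂ) (j : ℕ) : crystalPhase n x k j ≠ 0 := Complex.exp_ne_zero _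

theorem norm_crystalPhase (k : ℂ) (j : ℕ) :
    ‖crystalPhase n x k j‖ = Real.exp (-k.im * (n (j + 1) * (x (j + 1) - x j))) := by
  rw [crystalPhase, Complex.norm_exp]
  simp
  ring

theorem crystalPhase_add_real (z : ℂ) (τ : ℝ) (j : ℕ) :
    crystalPhase n x (z + τ) j
      = crystalPhase n x z j * Circle.exp (τ * (n (j + 1) * (x (j + 1) - x j))) := by
  rw [crystalPhase, crystalPhase, Circle.coe_exp, ← Complex.exp_add]
  push_cast
  ring_nf

/-- The secular function, whose zeros are the resonances, recurs along real translations. -/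
theorem crystal_recurrent (ν : ℝ) (N : ℕ) : ∃ τ : ℕ → ℝ, (∀ m : ℕ, (m : ℝ) ≤ τ m) ∧
    ∀ K : Set ℂ, IsCompact K → TendstoUniformlyOn
      (fun m (z : ℂ) => (crystalState n (crystalPhase n x (z + τ m)) N).2
        - ν * (crystalState n (crystalPhase n x (z + τ m)) N).1)
      (fun z => (crystalState n (crystalPhase n x z) N).2
        - ν * (crystalState n (crystalPhase n x z) N).1) atTop K := by
  obtain ⟨τ, hτ, hlim⟩ := exists_recurrence fun j => n (j + 1) * (x (j + 1) - x j)
  refine ⟨τ, hτ, fun K hK => ?_⟩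
  set G : (ℕ → Circle) × ℂ → ℂ := fun y =>
    (crystalState n (fun j => crystalPhase n x y.2 j * y.1 j) N).2
      - ν * (crystalState n (fun j => crystalPhase n x y.2 j * y.1 j) N).1 with hG
  have hGc : Continuous G := by
    have := continuous_crystalState (n := n)
      (e := fun (y : (ℕ → Circle) × ℂ) j => crystalPhase n x y.2 j * y.1 j)
      (fun j => by simp only [crystalPhase]; fun_prop)
      (fun y j => mul_ne_zero (crystalPhase_ne_zero _ _) (Circle.coe_ne_zero _)) N
    fun_prop
  have hG1 : ∀ z, G (1, z) = (crystalState n (crystalPhase n x z) N).2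
      - ν * (crystalState n (crystalPhase n x z) N).1 := by
    intro z; simp [hG]
  have hGτ : ∀ m z, G (fun j => Circle.exp (τ m * (n (j + 1) * (x (j + 1) - x j))), z)
      = (crystalState n (crystalPhase n x (z + τ m)) N).2
      - ν * (crystalState n (crystalPhase n x (z + τ m)) N).1 := by
    intro m z
    have : crystalPhase n x (z + τ m) = fun j => crystalPhase n x z j
        * Circle.exp (τ m * (n (j + 1) * (x (j + 1) - x j))) :=
      funext fun j => crystalPhase_add_real z (τ m) j
    simp only [hG, this]
  rw [Metric.tendstoUniformlyOn_iff]
  intro δ hδ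
  have hnear : ∀ᶠ w in 𝓝 (1 : ℕ → Circle), ∀ z ∈ K, dist (G (1, z)) (G (w, z)) < δ := by
    refine hK.eventually_forall_of_forall_eventually fun z _ => ?_
    have hcont : Continuous fun y : (ℕ → Circle) × ℂ => dist (G (1, y.2)) (G y) := by fun_prop
    exact hcont.continuousAt.eventually_lt continuousAt_const (by simpa using hδ)
  filter_upwards [hlim.eventually hnear] with m hm z hz
  have := hm z hz
  rwa [hG1, hGτ] at this

end Phase

/-- if the set of resonances of the 1-D photonic crystal is nonempty, it is
infinite and contained in a strip `−γ₀ ≤ Im k < 0`. -/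
theorem statement18 (N : ℕ) (hN : 1 ≤ N) (x ε : ℕ → ℝ)
    (hx : ∀ j, j < N → x j < x (j + 1)) (hε : ∀ j, j ≤ N + 1 → 0 < ε j)
    (hne : {k : ℂ | IsResonance N x ε k}.Nonempty) :
    {k : ℂ | IsResonance N x ε k}.Infinite ∧
    ∃ γ₀ : ℝ, 0 < γ₀ ∧ ∀ k : ℂ, IsResonance N x ε k → -γ₀ ≤ k.im ∧ k.im < 0 := by
  set n : ℕ → ℝ := fun j => √(ε j) with hndef
  have hn : ∀ j ≤ N + 1, 0 < n j := fun j hj => Real.sqrt_pos.2 (hε j hj)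
  have hn' : ∀ j ≤ N, 0 < n j := fun j hj => hn j (by omega)
  have hlen : ∀ j < N, 0 < n (j + 1) * (x (j + 1) - x j) := fun j hj =>
    mul_pos (hn _ (by omega)) (sub_pos.2 (hx j hj))
  have him : ∀ k : ℂ, (crystalState n (crystalPhase n x k) N).2
      = n (N + 1) * (crystalState n (crystalPhase n x k) N).1 → k.im < 0 := by
    intro k hk
    by_contra! him
    refine crystalState_not_outgoing hn' (crystalPhase_ne_zero k) (fun j hj => ?_)
      (hn _ le_rfl) hk
    rw [norm_crystalPhase, Real.exp_le_one_iff]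
    nlinarith [mul_nonneg him (hlen j hj).le]
  have hset : {k : ℂ | IsResonance N x ε k} = {k : ℂ | (crystalState n (crystalPhase n x k) N).2
      - n (N + 1) * (crystalState n (crystalPhase n x k) N).1 = 0} := by
    ext k
    rw [Set.mem_ofPred_eq, Set.mem_ofPred_eq, sub_eq_zero]
    refine ⟨fun h => h.outgoing hx hε, fun h => isResonance_of_outgoing hx hε ?_ h⟩
    rintro rfl
    simpa using him 0 h
  constructor
  · obtain ⟨k₀, hk₀⟩ := hne
    rw [hset] at hk₀ ⊢
    obtain ⟨τ, hτ, hrec⟩ := crystal_recurrent (n := n) (x := x) (n (N + 1)) N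
    have hdiff := differentiable_crystalState (n := n) (e := crystalPhase n x)
      (fun j => by unfold crystalPhase; fun_prop) crystalPhase_ne_zero N
    refine infinite_zeros_of_recurrent (hdiff.snd.sub (hdiff.fst.const_mul _)) hτ hrec hk₀
      (z₁ := 0) fun h => ?_
    simpa using him 0 (sub_eq_zero.1 h)
  · have hev := crystalState_eventually_not_outgoing (l := comap Complex.im atBot)
      (e := crystalPhase n x) hn'
      crystalPhase_ne_zero (fun j hj => ?_) N le_rfl (n (N + 1)) (hn _ le_rfl)
    · obtain ⟨b, hb⟩ := eventually_atBot.1 (eventually_comap.1 hev)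
      refine ⟨max 1 (-b), by positivity, fun k hk => ?_⟩
      have hk' := hk.outgoing hx hε
      refine ⟨?_, him k hk'⟩
      by_contra! hlt
      exact hb k.im (by linarith [le_max_right 1 (-b)]) k rfl hk'
    · simp only [norm_crystalPhase]
      exact Real.tendsto_exp_atTop.comp
        ((tendsto_neg_atBot_atTop.comp tendsto_comap).atTop_mul_const (hlen j hj))
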